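/- arXiv:math/0605656 — 2 statements merged into one kernel-verified Lean document; each statement's English description precedes it below -/
import Mathlib

section
/- Let G be a group with identity e and let c : G × G → ℤ be a bounded normalized 2-cocycle, i.e. c(g, e) = c(e, g) = 0 for all g ∈ G, c(g₁, g₂) + c(g₁g₂, g₃) = c(g₁, g₂g₃) + c(g₂, g₃) for all g₁, g₂, g₃ ∈ G, and sup_{g₁,g₂} |c(g₁,g₂)| < ∞. Let G_c denote the set G × ℤ endowed with the group multiplication (g₁, n₁)·(g₂, n₂) := (g₁g₂, n₁ + n₂ + c(g₁, g₂)). Then there exists a homogeneous quasimorphism f : G_c → ℝ such that (i) f((e, n)·x) = n + f(x) for every n ∈ ℤ and every x ∈ G_c, and (ii) |f(g, m) − m| ≤ sup_{g₁,g₂} |c(g₁,g₂)| for every (g, m) ∈ G_c. -/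
/-- The twisted multiplication on `G × ℤ` determined by a `ℤ`-valued 2-cocycle `c` on `G`:
`(g₁, n₁) * (g₂, n₂) = (g₁ g₂, n₁ + n₂ + c g₁ g₂)`. -/
def twistedMul {G : Type*} [Group G] (c : G → G → ℤ) (x y : G × ℤ) : G × ℤ :=
  (x.1 * y.1, x.2 + y.2 + c x.1 y.1)

/-- The inverse in the central extension `G_c = G × ℤ` with twisted multiplication. -/
def twistedInv {G : Type*} [Group G] (c : G → G → ℤ) (x : G × ℤ) : G × ℤ :=
  (x.1⁻¹, -x.2 - c x.1 x.1⁻¹)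

/-- Natural powers in the central extension `G_c = G × ℤ` with twisted multiplication. -/
def twistedPow {G : Type*} [Group G] (c : G → G → ℤ) (x : G × ℤ) : ℕ → G × ℤ
  | 0 => (1, 0)
  | n + 1 => twistedMul c x (twistedPow c x n)

/-- Integer powers in the central extension `G_c = G × ℤ` with twisted multiplication. -/
def twistedZPow {G : Type*} [Group G] (c : G → G → ℤ) (x : G × ℤ) : ℤ → G × ℤ
  | Int.ofNat n => twistedPow c x n
  | Int.negSucc n => twistedInv c (twistedPow c x (n + 1))

open Filter Topology in
/-- If `φ` has defect at most `B`, then `φ (x ^ n) / n` converges. -/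
theorem exists_tendsto_div_of_defect_le {H : Type*} [Group H] {φ : H → ℝ} {B : ℝ}
    (hφ : ∀ x y, |φ (x * y) - φ x - φ y| ≤ B) (x : H) :
    ∃ l : ℝ, |l - φ x| ≤ B ∧ Tendsto (fun n : ℕ => φ (x ^ n) / n) atTop (𝓝 l) := by
  have hB : 0 ≤ B := (abs_nonneg _).trans (hφ x x)
  have hpow : ∀ n : ℕ, |φ (x ^ (n + 1)) - (n + 1) * φ x| ≤ n * B := by
    intro n
    induction n with
    | zero => simp
    | succ k ih =>
      have h := hφ (x ^ (k + 1)) x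
      rw [← pow_succ] at h
      push_cast
      rw [abs_le] at h ih ⊢
      constructor <;> linarith
  have hdiv : ∀ n : ℕ, 0 < n → |φ (x ^ n) / n - φ x| ≤ B := by
    intro n hn
    obtain ⟨k, rfl⟩ := Nat.exists_eq_succ_of_ne_zero hn.ne'
    have hk : (0 : ℝ) < (k.succ : ℝ) := by positivity
    rw [div_sub' hk.ne', abs_div, abs_of_pos hk, div_le_iff₀ hk]
    have h := hpow k
    push_cast
    linarith
  have hsub : Subadditive fun n : ℕ => φ (x ^ n) + B := by
    intro m n
    have h := (abs_le.1 (hφ (x ^ m) (x ^ n))).2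
    rw [← pow_add] at h
    dsimp only
    linarith
  have hbdd : BddBelow (Set.range fun n : ℕ => (φ (x ^ n) + B) / n) := by
    refine ⟨min 0 (φ x - B), ?_⟩
    rintro _ ⟨n, rfl⟩
    rcases Nat.eq_zero_or_pos n with rfl | hn
    · simp
    · have h := (abs_le.1 (hdiv n hn)).1
      have h' : 0 ≤ B / n := by positivity
      refine (min_le_right _ _).trans ?_
      dsimp only
      rw [add_div]
      linarith
  have hlim : Tendsto (fun n : ℕ => φ (x ^ n) / n) atTop (𝓝 hsub.lim) := by
    have h := (hsub.tendsto_lim hbdd).sub (tendsto_const_div_atTop_nhds_zero_nat B)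
    rw [sub_zero] at h
    refine h.congr fun n => ?_
    rw [add_div, add_sub_cancel_right]
  refine ⟨hsub.lim, ?_, hlim⟩
  refine le_of_tendsto (hlim.sub_const (φ x)).abs ?_
  filter_upwards [eventually_gt_atTop 0] with n hn using hdiv n hn

open Filter Topology in
/-- Homogenization of a quasimorphism: a function of defect at most `B` is within `B` of a function
which is homogeneous and additive on commuting pairs. -/
theorem exists_homogenization {H : Type*} [Group H] {φ : H → ℝ} {B : ℝ}
    (hφ : ∀ x y, |φ (x * y) - φ x - φ y| ≤ B) :
    ∃ f : H → ℝ, (∀ x (n : ℤ), f (x ^ n) = n * f x) ∧ (∀ x, |f x - φ x| ≤ B) ∧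
      (∀ x y, Commute x y → f (x * y) = f x + f y) := by
  choose f hclose hlim using exists_tendsto_div_of_defect_le hφ
  have hcomm : ∀ x y, Commute x y → f (x * y) = f x + f y := by
    intro x y hxy
    have h := ((hlim (x * y)).sub (hlim x)).sub (hlim y)
    have h0 : Tendsto (fun n : ℕ => φ ((x * y) ^ n) / n - φ (x ^ n) / n - φ (y ^ n) / n)
        atTop (𝓝 0) := by
      refine squeeze_zero_norm (fun n => ?_) (tendsto_const_div_atTop_nhds_zero_nat B)
      rw [hxy.mul_pow, ← sub_div, ← sub_div, Real.norm_eq_abs, abs_div, Nat.abs_cast]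
      gcongr
      exact hφ _ _
    linarith [tendsto_nhds_unique h h0]
  have hone : f 1 = 0 := by
    have h := hcomm 1 1 (Commute.refl 1)
    rw [mul_one] at h
    linarith
  have hinv : ∀ x, f x⁻¹ = -f x := by
    intro x
    have h := hcomm x x⁻¹ (Commute.refl x).inv_right
    rw [mul_inv_cancel, hone] at h
    linarith
  have hnat : ∀ x (n : ℕ), f (x ^ n) = n * f x := by
    intro x n
    induction n with
    | zero => simp [hone]
    | succ k ih =>
      rw [pow_succ, hcomm _ _ (Commute.pow_self x k), ih]
      push_cast
      ring
  refine ⟨f, fun x n => ?_, hclose, hcomm⟩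
  obtain ⟨k, rfl | rfl⟩ := n.eq_nat_or_neg
  · simp [hnat]
  · simp [hnat, hinv]

/-- Two reals whose natural multiples stay at bounded distance are equal. -/
theorem eq_of_forall_abs_natCast_mul_sub_le {a b B : ℝ}
    (h : ∀ k : ℕ, |(k : ℝ) * a - k * b| ≤ B) : a = b := by
  by_contra hne
  have hpos : 0 < |a - b| := abs_pos.2 (sub_ne_zero.2 hne)
  obtain ⟨k, hk⟩ := exists_nat_gt (B / |a - b|)
  rw [div_lt_iff₀ hpos] at hk
  have hk' := h k
  rw [← mul_sub, abs_mul, Nat.abs_cast] at hk'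
  linarith

/-- The central extension `G × ℤ` with twisted multiplication is a group. -/
abbrev twistedGroup {G : Type*} [Group G] (c : G → G → ℤ)
    (hnorm_right : ∀ g : G, c g 1 = 0) (hnorm_left : ∀ g : G, c 1 g = 0)
    (hcocycle : ∀ g₁ g₂ g₃ : G, c g₁ g₂ + c (g₁ * g₂) g₃ = c g₁ (g₂ * g₃) + c g₂ g₃) :
    Group (G × ℤ) :=
  letI : Mul (G × ℤ) := ⟨twistedMul c⟩
  letI : One (G × ℤ) := ⟨(1, 0)⟩
  letI : Inv (G × ℤ) := ⟨twistedInv c⟩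
  Group.ofLeftAxioms
    (fun x y z => Prod.ext (mul_assoc x.1 y.1 z.1) (by
      change x.2 + y.2 + c x.1 y.1 + z.2 + c (x.1 * y.1) z.1 =
        x.2 + (y.2 + z.2 + c y.1 z.1) + c x.1 (y.1 * z.1)
      linarith [hcocycle x.1 y.1 z.1]))
    (fun x => Prod.ext (one_mul x.1) (by
      change 0 + x.2 + c 1 x.1 = x.2
      rw [hnorm_left, zero_add, add_zero]))
    (fun x => Prod.ext (inv_mul_cancel x.1) (by
      change -x.2 - c x.1 x.1⁻¹ + x.2 + c x.1⁻¹ x.1 = 0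
      have h := hcocycle x.1 x.1⁻¹ x.1
      rw [mul_inv_cancel, inv_mul_cancel, hnorm_left, hnorm_right] at h
      linarith))

/-- **Algebraic core of Proposition 7.4.** Let `G` be a group and `c : G × G → ℤ` a bounded
normalized 2-cocycle, and let `G_c` be the set `G × ℤ` endowed with the twisted group
multiplication `(g₁, n₁)·(g₂, n₂) = (g₁ g₂, n₁ + n₂ + c g₁ g₂)`.  Then there is a
homogeneous quasimorphism `f : G_c → ℝ` such that `f ((e, n)·x) = n + f x` for all `n : ℤ`
and `x : G_c`, and `|f (g, m) - m|` is bounded by the supremum of `|c|`. -/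
theorem central_extension_quasimorphism
    {G : Type*} [Group G] (c : G → G → ℤ) (B : ℤ)
    (hnorm_right : ∀ g : G, c g 1 = 0)
    (hnorm_left : ∀ g : G, c 1 g = 0)
    (hcocycle : ∀ g₁ g₂ g₃ : G,
      c g₁ g₂ + c (g₁ * g₂) g₃ = c g₁ (g₂ * g₃) + c g₂ g₃)
    (hB : ∀ g₁ g₂ : G, |c g₁ g₂| ≤ B) :
    ∃ f : G × ℤ → ℝ,
      -- `f` is homogeneous (with respect to the twisted integer powers):
      (∀ (x : G × ℤ) (n : ℤ), f (twistedZPow c x n) = (n : ℝ) * f x) ∧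
      -- `f` is a quasimorphism (with respect to the twisted multiplication):
      (∃ D : ℝ, ∀ x y : G × ℤ, |f (twistedMul c x y) - f x - f y| ≤ D) ∧
      -- (i): `f ((e, n) · x) = n + f x`:
      (∀ (n : ℤ) (x : G × ℤ), f (twistedMul c ((1 : G), n) x) = (n : ℝ) + f x) ∧
      -- (ii): `|f (g, m) - m| ≤ B`:
      (∀ (g : G) (m : ℤ), |f (g, m) - (m : ℝ)| ≤ (B : ℝ)) := by
  let inst : Group (G × ℤ) := twistedGroup c hnorm_right hnorm_left hcocycle
  have hpow : ∀ (x : G × ℤ) (n : ℕ), twistedPow c x n = inst.npow n x := by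
    intro x n
    induction n with
    | zero => exact (@pow_zero _ inst.toMonoid x).symm
    | succ k ih =>
      refine Eq.trans ?_ (@pow_succ' _ inst.toMonoid x k).symm
      exact congrArg (twistedMul c x) ih
  have hzpow : ∀ (x : G × ℤ) (n : ℤ), twistedZPow c x n = inst.zpow n x := by
    intro x n
    cases n with
    | ofNat k => exact (hpow x k).trans (@zpow_natCast _ inst.toDivInvMonoid x k).symm
    | negSucc k =>
      refine Eq.trans ?_ (@zpow_negSucc _ inst.toDivInvMonoid x k).symm
      exact congrArg (twistedInv c) (hpow x (k + 1))
  have hdefect : ∀ x y : G × ℤ,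
      |((twistedMul c x y).2 : ℝ) - (x.2 : ℝ) - (y.2 : ℝ)| ≤ (B : ℝ) := by
    intro x y
    have h : ((twistedMul c x y).2 : ℝ) - x.2 - y.2 = (c x.1 y.1 : ℝ) := by
      simp only [twistedMul]
      push_cast
      ring
    rw [h]
    exact_mod_cast hB x.1 y.1
  obtain ⟨f, hhom, hclose, hcomm⟩ :=
    @exists_homogenization (G × ℤ) inst (fun x => (x.2 : ℝ)) B hdefect
  have hhom' : ∀ (x : G × ℤ) (n : ℤ), f (twistedZPow c x n) = (n : ℝ) * f x := fun x n =>
    (congrArg f (hzpow x n)).trans (hhom x n)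
  have hcentral_pow : ∀ (n : ℤ) (k : ℕ), twistedPow c ((1 : G), n) k = (1, k * n) := by
    intro n k
    induction k with
    | zero => simp [twistedPow]
    | succ k ih =>
      rw [twistedPow, ih]
      refine Prod.ext (mul_one 1) ?_
      simp only [twistedMul, hnorm_left]
      push_cast
      ring
  have hcentral : ∀ n : ℤ, f ((1 : G), n) = n := by
    intro n
    refine eq_of_forall_abs_natCast_mul_sub_le (B := B) fun k => ?_
    have h := hclose (twistedPow c ((1 : G), n) k)
    have h' : f (twistedPow c ((1 : G), n) k) = k * f (1, n) := by
      exact_mod_cast hhom' (1, n) k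
    rw [h', hcentral_pow] at h
    simpa using h
  refine ⟨f, hhom', ⟨4 * B, fun x y => ?_⟩, fun n x => ?_, fun g m => hclose (g, m)⟩
  · have h₁ := abs_le.1 (hclose (twistedMul c x y))
    have h₂ := abs_le.1 (hclose x)
    have h₃ := abs_le.1 (hclose y)
    have h₄ := abs_le.1 (hdefect x y)
    rw [abs_le]
    constructor <;> linarith [h₁.1, h₁.2, h₂.1, h₂.2, h₃.1, h₃.2, h₄.1, h₄.2]
  · rw [← hcentral n]
    refine hcomm (1, n) x ?_
    change twistedMul c (1, n) x = twistedMul c x (1, n)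
    simp [twistedMul, hnorm_left, hnorm_right, add_comm]
end

section
/- Let N ≥ 1 and d ≥ 1, let p be a nonzero homogeneous polynomial of degree d in N+1 real variables, and let V := {x ∈ S^N : p(x) = 0} be its zero set on the unit sphere S^N ⊂ ℝ^{N+1}. Let (g_n) be a sequence in GL(N+1, ℝ), acting on S^N by x ↦ g_n·x/‖g_n·x‖. Then there exist a subsequence (g_{n_k}) and a nonzero homogeneous polynomial q of degree d in N+1 real variables such that for every ε > 0 there is an index K with the property: for all k ≥ K and all x ∈ V, the point g_{n_k}·x/‖g_{n_k}·x‖ lies within Euclidean distance ε of the set {y ∈ S^N : q(y) = 0}. -/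
open Filter Topology

open MvPolynomial in
/-- After passing to a subsequence, a sequence of nonzero homogeneous polynomials of degree `d`
converges, up to rescaling, to a nonzero homogeneous polynomial `q` of degree `d`; in particular
the zero sets eventually avoid every compact set on which `q` does not vanish. -/
theorem exists_subseq_eval_ne_zero_on_compact {σ : Type*} [Fintype σ] {d : ℕ}
    (Q : ℕ → MvPolynomial σ ℝ) (hQ : ∀ n, Q n ≠ 0) (hQhom : ∀ n, (Q n).IsHomogeneous d) :
    ∃ k : ℕ → ℕ, StrictMono k ∧ ∃ q : MvPolynomial σ ℝ, q ≠ 0 ∧ q.IsHomogeneous d ∧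
      ∀ A : Set (σ → ℝ), IsCompact A → (∀ z ∈ A, eval z q ≠ 0) →
        ∀ᶠ n in atTop, ∀ z ∈ A, eval z (Q (k n)) ≠ 0 := by
  have : Module.Finite ℝ (homogeneousSubmodule σ ℝ d) :=
    Module.Finite.iff_fg.mpr (homogeneousSubmodule_fg σ ℝ d)
  let b := Module.finBasis ℝ (homogeneousSubmodule σ ℝ d)
  let e := b.equivFun
  let P : ℕ → homogeneousSubmodule σ ℝ d := fun n => ⟨Q n, hQhom n⟩
  have heP : ∀ n, e (P n) ≠ 0 := fun n h => hQ n <| by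
    simpa [P] using congrArg Subtype.val (e.map_eq_zero_iff.mp h)
  obtain ⟨c, hc, k, hk, hlim⟩ := (isCompact_sphere (0 : Fin _ → ℝ) 1).tendsto_subseq
    (x := fun n => ‖e (P n)‖⁻¹ • e (P n)) fun n => by
      simp [norm_smul, inv_mul_cancel₀ (norm_ne_zero_iff.mpr (heP n))]
  have hc0 : c ≠ 0 := by
    rintro rfl
    simp at hc
  refine ⟨k, hk, e.symm c, ?_, (e.symm c).2, fun A hA hne => ?_⟩
  · simpa using hc0
  have hcont : Continuous fun w : (Fin _ → ℝ) × (σ → ℝ) =>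
      eval w.2 (e.symm w.1 : MvPolynomial σ ℝ) := by
    have : ∀ w : (Fin _ → ℝ) × (σ → ℝ), eval w.2 (e.symm w.1 : MvPolynomial σ ℝ) =
        ∑ i, w.1 i * eval w.2 (b i : MvPolynomial σ ℝ) := fun w => by
      simp [e, Module.Basis.equivFun_symm_apply, smul_eval]
    simp only [this]
    exact continuous_finsetSum _ fun i _ => ((continuous_apply i).comp continuous_fst).mul
      ((continuous_eval _).comp continuous_snd)
  have hev := hA.eventually_forall_of_forall_eventually (x₀ := c)
    (P := fun c z => eval z (e.symm c : MvPolynomial σ ℝ) ≠ 0)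
    fun z hz => hcont.continuousAt.eventually_ne (hne z hz)
  filter_upwards [hlim.eventually hev] with n hn z hz h0
  apply hn z hz
  simp [P, smul_eval, h0]

open MvPolynomial in
/-- Precomposing a nonzero homogeneous polynomial with an invertible linear map gives a nonzero
homogeneous polynomial of the same degree. -/
theorem exists_isHomogeneous_eval_mulVec {σ : Type*} [Fintype σ] [DecidableEq σ] {d : ℕ}
    {p : MvPolynomial σ ℝ} (hp : p ≠ 0) (hphom : p.IsHomogeneous d)
    (g : Matrix.GeneralLinearGroup σ ℝ) :
    ∃ q : MvPolynomial σ ℝ, q ≠ 0 ∧ q.IsHomogeneous d ∧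
      ∀ x : σ → ℝ, eval ((g : Matrix σ σ ℝ).mulVec x) q = eval x p := by
  let M : Matrix σ σ ℝ := ((g⁻¹ : Matrix.GeneralLinearGroup σ ℝ) : Matrix σ σ ℝ)
  let q : MvPolynomial σ ℝ := aeval (fun i => ∑ j, C (M i j) * X j) p
  have heval : ∀ z : σ → ℝ, eval z q = eval (M.mulVec z) p := fun z => by
    have : eval z q = aeval z q := rfl
    rw [this, ← AlgHom.comp_apply, comp_aeval]
    simp [aeval_eq_eval]
    rfl
  have hgx : ∀ x : σ → ℝ, eval ((g : Matrix σ σ ℝ).mulVec x) q = eval x p := fun x => by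
    rw [heval, Matrix.mulVec_mulVec, ← Units.val_mul, inv_mul_cancel, Units.val_one,
      Matrix.one_mulVec]
  refine ⟨q, ?_, ?_, hgx⟩
  · intro h0
    refine hp (MvPolynomial.funext fun x => ?_)
    rw [← hgx x, h0, map_zero, map_zero]
  · rw [← one_mul d]
    exact hphom.aeval _ fun i => IsHomogeneous.sum _ _ _ fun j _ => isHomogeneous_C_mul_X _ _

open MvPolynomial in
/-- A homogeneous polynomial of degree `d` scales by `r ^ d` when its argument is scaled by `r`. -/
theorem MvPolynomial.IsHomogeneous.eval_smul {σ R : Type*} [Fintype σ] [CommSemiring R] {d : ℕ}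
    {q : MvPolynomial σ R} (hq : q.IsHomogeneous d) (r : R) (x : σ → R) :
    eval (r • x) q = r ^ d * eval x q := by
  rw [eval_eq', eval_eq', Finset.mul_sum]
  refine Finset.sum_congr rfl fun m hm => ?_
  have hdeg : ∑ i, m i = d := by
    rw [← Finsupp.degree_eq_sum]
    by_contra h
    exact mem_support_iff.mp hm (hq.coeff_eq_zero h)
  simp only [Pi.smul_apply, smul_eq_mul, mul_pow, Finset.prod_mul_distrib,
    Finset.prod_pow_eq_pow_sum, hdeg]
  ring

/-- **Lemma 5.4 (realized on the unit sphere of `ℝ^{N+1}`).** Let `p` be a nonzero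
homogeneous polynomial of degree `d ≥ 1` in `N + 1` real variables, `V` its zero set on the
unit sphere `S^N ⊂ ℝ^{N+1}`, and `(gₙ)` a sequence in `GL(N+1, ℝ)` acting on `S^N` by
`x ↦ gₙ x / ‖gₙ x‖`.  Then there are a subsequence `(g_{n_k})` and a nonzero homogeneous
polynomial `q` of degree `d` such that for every `ε > 0` there is `K` with: for all `k ≥ K`
and all `x ∈ V`, the point `g_{n_k} x / ‖g_{n_k} x‖` lies within distance `ε` of the zero
set of `q` on `S^N`. -/
theorem zero_sets_subconverge_to_zero_set
    (N d : ℕ) (hN : 1 ≤ N) (hd : 1 ≤ d)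
    (p : MvPolynomial (Fin (N + 1)) ℝ) (hp : p ≠ 0) (hphom : p.IsHomogeneous d)
    (g : ℕ → Matrix.GeneralLinearGroup (Fin (N + 1)) ℝ) :
    ∃ k : ℕ → ℕ, StrictMono k ∧
      ∃ q : MvPolynomial (Fin (N + 1)) ℝ, q ≠ 0 ∧ q.IsHomogeneous d ∧
        ∀ ε : ℝ, 0 < ε → ∃ K : ℕ, ∀ j : ℕ, K ≤ j →
          ∀ x : EuclideanSpace ℝ (Fin (N + 1)), ‖x‖ = 1 →
            MvPolynomial.eval (fun i => x i) p = 0 →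
              ∃ y : EuclideanSpace ℝ (Fin (N + 1)), ‖y‖ = 1 ∧
                MvPolynomial.eval (fun i => y i) q = 0 ∧
                dist
                  ((‖Matrix.toEuclideanLin
                      ((g (k j) : Matrix (Fin (N + 1)) (Fin (N + 1)) ℝ)) x‖)⁻¹ •
                    Matrix.toEuclideanLin
                      ((g (k j) : Matrix (Fin (N + 1)) (Fin (N + 1)) ℝ)) x)
                  y ≤ ε := by
  choose Q hQ0 hQhom hQ using fun n => exists_isHomogeneous_eval_mulVec hp hphom (g n)
  obtain ⟨k, hk, q, hq0, hqhom, hq⟩ := exists_subseq_eval_ne_zero_on_compact Q hQ0 hQhom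
  refine ⟨k, hk, q, hq0, hqhom, fun ε hε => ?_⟩
  let A : Set (EuclideanSpace ℝ (Fin (N + 1))) := Metric.sphere 0 1 ∩
    ⋂ y ∈ {y | ‖y‖ = 1 ∧ MvPolynomial.eval (fun i => y i) q = 0}, {z | ε ≤ dist z y}
  have hA : IsCompact A := (isCompact_sphere _ _).inter_right <|
    isClosed_biInter fun y _ => isClosed_le continuous_const (by fun_prop)
  have hev := hq _ (hA.image (PiLp.continuous_ofLp 2 _)) <| by
    rintro _ ⟨z, ⟨hz1, hz2⟩, rfl⟩ h0
    have := Set.mem_iInter₂.mp hz2 z ⟨by simpa using hz1, h0⟩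
    simp only [Set.mem_ofPred_eq, dist_self] at this
    exact hε.not_ge this
  obtain ⟨K, hK⟩ := eventually_atTop.mp hev
  refine ⟨K, fun j hj x hx hpx => ?_⟩
  by_contra! hfar
  set v := Matrix.toEuclideanLin ((g (k j) : Matrix (Fin (N + 1)) (Fin (N + 1)) ℝ)) x
  have hvx : v.ofLp = (g (k j) : Matrix (Fin (N + 1)) (Fin (N + 1)) ℝ).mulVec x.ofLp := rfl
  have hQv : MvPolynomial.eval v.ofLp (Q (k j)) = 0 := by
    rw [hvx, hQ]
    exact hpx
  have hv0 : v ≠ 0 := by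
    intro h
    have hinj := Matrix.mulVec_injective_of_isUnit (g (k j)).isUnit
    have hx0 : x.ofLp = 0 := hinj <| by
      rw [← hvx, h, Matrix.mulVec_zero]
      rfl
    have : x = 0 := by
      ext i
      exact congrFun hx0 i
    simp [this] at hx
  refine hK j hj _ ⟨‖v‖⁻¹ • v, ⟨?_, ?_⟩, rfl⟩ (((hQhom (k j)).eval_smul _ _).trans (mul_eq_zero_of_right _ hQv))
  · simp [norm_smul, inv_mul_cancel₀ (norm_ne_zero_iff.mpr hv0)]
  · exact Set.mem_iInter₂.mpr fun y hy => (hfar y hy.1 hy.2).le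
end
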